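/- arXiv:2210.17070 — 5 statements merged into one kernel-verified Lean document; each statement's English description precedes it below -/
import Mathlib

section
/- Fix D, H, λ > 0, let X = [−D, D] ⊂ ℝ and L = 2HD. Let 𝒮 be a sample space and F : ℝ × 𝒮 → [0,∞) a loss such that for every s ∈ 𝒮 the function F(·; s) is convex, differentiable, H-smooth, and attains its minimum value 0 at some point of [−D, D]; assume there exist s₊, s₋ ∈ 𝒮 with F(x; s₊) = (H/2)(x − D)² and F(x; s₋) = (H/2)(x + D)² for all x. Let k be a positive integer with λn > kH, and let S ∈ 𝒮^n be a dataset such that F_S is L-Lipschitz and λ-strongly convex on X and (F, S) is an interpolation problem over X. For any dataset T ∈ 𝒮^n whose empirical risk F_T is L-Lipschitz and λ-strongly convex on X, let x*_T denote the unique minimizer of F_T over X, and define the modulus of continuity ω(S, k) = sup { |x*_S − x*_{S'}| : S' ∈ 𝒮^n, F_{S'} is L-Lipschitz and λ-strongly convex on X, and the Hamming distance between S and S' is at most k }. Then k·D/n ≤ ω(S, k) ≤ 8·k·H·D / (λ·n). -/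
open MeasureTheory Real

/-- The empirical risk `F_S(x) = (1/n)·Σᵢ F(x; sᵢ)` of a dataset `S`. -/
noncomputable def empRisk {E 𝒮 : Type*} {n : ℕ} (F : E → 𝒮 → ℝ) (S : Fin n → 𝒮) : E → ℝ :=
  fun x => (1 / n : ℝ) * ∑ i, F x (S i)

/-- `(F, S)` is an interpolation problem over `X`: some minimizer `x*` of `F_S` over `X`
has `0 ∈ ∂F(x*; sᵢ)` for every `i` (for a convex loss, `0` is a subgradient of `F(·; sᵢ)`
at `x*` iff `x*` minimizes `F(·; sᵢ)` globally). -/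
def IsInterpolation {E 𝒮 : Type*} {n : ℕ} (F : E → 𝒮 → ℝ) (S : Fin n → 𝒮) (X : Set E) : Prop :=
  ∃ xstar ∈ X, IsMinOn (empRisk F S) X xstar ∧ ∀ i, ∀ y, F xstar (S i) ≤ F y (S i)

/-- A differentiable `h : ℝ → ℝ` is `λ`-strongly convex on `X`:
`h(y) ≥ h(x) + h'(x)(y − x) + (λ/2)(y − x)²` for all `x, y ∈ X`. -/
def StrongConvexOnDeriv (h : ℝ → ℝ) (X : Set ℝ) (lam : ℝ) : Prop :=
  ∀ x ∈ X, ∀ y ∈ X, h y ≥ h x + deriv h x * (y - x) + lam / 2 * (y - x) ^ 2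

/-- `h` is `L`-Lipschitz on `X`. -/
def LipschitzOnWithReal (h : ℝ → ℝ) (X : Set ℝ) (L : ℝ) : Prop :=
  ∀ x ∈ X, ∀ y ∈ X, |h x - h y| ≤ L * |x - y|

/-- Descent lemma on the real line: a function with `H`-Lipschitz derivative lies below its
quadratic upper model. -/
theorem le_quadratic_of_deriv_lipschitz {f : ℝ → ℝ} {H : ℝ} (hf : Differentiable ℝ f)
    (hs : ∀ x y, |deriv f x - deriv f y| ≤ H * |x - y|) (x y : ℝ) :
    f y ≤ f x + deriv f x * (y - x) + H / 2 * (y - x) ^ 2 := by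
  let g : ℝ → ℝ := fun t => deriv f x * (t - x) + H / 2 * (t - x) ^ 2 - f t
  have hg : ∀ t, HasDerivAt g (deriv f x + H * (t - x) - deriv f t) t := by
    intro t
    have h1 : HasDerivAt (fun t : ℝ => t - x) 1 t := (hasDerivAt_id t).sub_const x
    have h2 := ((h1.const_mul (deriv f x)).add ((h1.pow 2).const_mul (H / 2))).sub
      (hf t).hasDerivAt
    refine h2.congr_deriv ?_
    push_cast
    ring
  have hc : Continuous g := continuous_iff_continuousAt.2 fun t => (hg t).continuousAt
  suffices h : g x ≤ g y by
    simp only [g] at h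
    nlinarith
  rcases lt_trichotomy x y with h | h | h
  · obtain ⟨t, ht, hte⟩ := exists_hasDerivAt_eq_slope g _ h hc.continuousOn fun t _ => hg t
    rw [eq_div_iff (by linarith)] at hte
    have h3 := (abs_le.1 (hs t x)).2
    rw [abs_of_pos (by linarith [ht.1])] at h3
    have := mul_nonneg (show 0 ≤ deriv f x + H * (t - x) - deriv f t by linarith)
      (show 0 ≤ y - x by linarith)
    linarith
  · rw [h]
  · obtain ⟨t, ht, hte⟩ := exists_hasDerivAt_eq_slope g _ h hc.continuousOn fun t _ => hg t
    rw [eq_div_iff (by linarith)] at hte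
    have h3 := (abs_le.1 (hs t x)).1
    rw [abs_of_neg (by linarith [ht.2])] at h3
    have := mul_nonneg (show 0 ≤ -(deriv f x + H * (t - x) - deriv f t) by linarith)
      (show 0 ≤ x - y by linarith)
    linarith

theorem deriv_eq_zero_of_nonneg {f : ℝ → ℝ} (hf : ∀ x, 0 ≤ f x) {z : ℝ} (hz : f z = 0) :
    deriv f z = 0 :=
  IsLocalMin.deriv_eq_zero (Filter.Eventually.of_forall fun y => hz ▸ hf y)

section EmpRisk

variable {𝒮 : Type*} {n : ℕ} {F : ℝ → 𝒮 → ℝ}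

theorem hasDerivAt_empRisk (hdiff : ∀ s, Differentiable ℝ (fun x => F x s)) (S : Fin n → 𝒮)
    (x : ℝ) :
    HasDerivAt (empRisk F S) ((1 / n : ℝ) * ∑ i, deriv (fun x => F x (S i)) x) x :=
  (HasDerivAt.fun_sum fun i _ => (hdiff (S i) x).hasDerivAt).const_mul _

theorem abs_deriv_le_of_smooth {D H : ℝ} (hH : 0 ≤ H) (hnonneg : ∀ x s, 0 ≤ F x s)
    (hsmooth : ∀ s, ∀ x y : ℝ,
      |deriv (fun x => F x s) x - deriv (fun x => F x s) y| ≤ H * |x - y|)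
    (hmin : ∀ s, ∃ x ∈ Set.Icc (-D) D, F x s = 0) (s : 𝒮) {x : ℝ} (hx : x ∈ Set.Icc (-D) D) :
    |deriv (fun x => F x s) x| ≤ 2 * H * D := by
  obtain ⟨z, hz, hz0⟩ := hmin s
  have h := hsmooth s x z
  rw [deriv_eq_zero_of_nonneg (fun x => hnonneg x s) hz0, sub_zero] at h
  have h2 : |x - z| ≤ 2 * D := abs_le.2 ⟨by linarith [hx.1, hz.2], by linarith [hx.2, hz.1]⟩
  nlinarith

theorem lipschitzOn_empRisk {D L : ℝ} (hn : 0 < n)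
    (hdiff : ∀ s, Differentiable ℝ (fun x => F x s))
    (hb : ∀ s, ∀ x ∈ Set.Icc (-D) D, |deriv (fun x => F x s) x| ≤ L) (S : Fin n → 𝒮) :
    LipschitzOnWithReal (empRisk F S) (Set.Icc (-D) D) L := by
  have hn' : (0 : ℝ) < n := Nat.cast_pos.2 hn
  intro x hx y hy
  refine (convex_Icc (-D) D).norm_image_sub_le_of_norm_hasDerivWithin_le
    (fun t _ => (hasDerivAt_empRisk hdiff S t).hasDerivWithinAt) (fun t ht => ?_) hy hx
  rw [Real.norm_eq_abs, abs_mul, abs_of_pos (by positivity), one_div, inv_mul_le_iff₀ hn']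
  calc _ ≤ ∑ i, |deriv (fun x => F x (S i)) t| := Finset.abs_sum_le_sum_abs _ _
    _ ≤ ∑ _i : Fin n, L := Finset.sum_le_sum fun i _ => hb _ _ ht
    _ = n * L := by simp

/-- At a minimizer of an interpolating empirical risk every individual loss vanishes. -/
theorem IsInterpolation.eq_zero {X : Set ℝ} {S : Fin n → 𝒮} (h : IsInterpolation F S X)
    (hn : 0 < n) (hnonneg : ∀ x s, 0 ≤ F x s) (hmin : ∀ s, ∃ x, F x s = 0)
    {x : ℝ} (hxmin : IsMinOn (empRisk F S) X x) (i : Fin n) : F x (S i) = 0 := by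
  have hn' : (0 : ℝ) < n := Nat.cast_pos.2 hn
  obtain ⟨z, hzX, -, hz⟩ := h
  have hz0 : ∀ i, F z (S i) = 0 := fun i => by
    obtain ⟨w, hw⟩ := hmin (S i)
    exact le_antisymm (hw ▸ hz i w) (hnonneg _ _)
  have h1 : empRisk F S x ≤ empRisk F S z := hxmin hzX
  simp only [empRisk, hz0, Finset.sum_const_zero, mul_zero] at h1
  have h2 : ∑ i, F x (S i) ≤ 0 := by
    by_contra! hlt
    have : 0 < (1 / n : ℝ) * ∑ i, F x (S i) := by positivity
    linarith
  have h3 := (Finset.sum_eq_zero_iff_of_nonneg fun i _ => hnonneg x (S i)).1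
    (le_antisymm h2 (Finset.sum_nonneg fun i _ => hnonneg x (S i)))
  exact h3 i (Finset.mem_univ i)

theorem empRisk_bregman (hdiff : ∀ s, Differentiable ℝ (fun x => F x s)) (S : Fin n → 𝒮)
    (x y : ℝ) :
    empRisk F S y - empRisk F S x - deriv (empRisk F S) x * (y - x) =
      (1 / n : ℝ) * ∑ i, (F y (S i) - F x (S i) - deriv (fun x => F x (S i)) x * (y - x)) := by
  rw [(hasDerivAt_empRisk hdiff S x).deriv, Finset.sum_sub_distrib, Finset.sum_sub_distrib,
    ← Finset.sum_mul]
  simp only [empRisk]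
  ring

/-- Replacing samples by quadratics of the largest admissible curvature preserves strong
convexity. -/
theorem StrongConvexOnDeriv.replace {H lam c : ℝ} {X : Set ℝ}
    (hdiff : ∀ s, Differentiable ℝ (fun x => F x s))
    (hsmooth : ∀ s, ∀ x y : ℝ,
      |deriv (fun x => F x s) x - deriv (fun x => F x s) y| ≤ H * |x - y|)
    {s : 𝒮} (hs : ∀ x, F x s = H / 2 * (x - c) ^ 2)
    (hds : ∀ x, deriv (fun x => F x s) x = H * (x - c))
    {S : Fin n → 𝒮} (hS : StrongConvexOnDeriv (empRisk F S) X lam) (T : Finset (Fin n)) :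
    StrongConvexOnDeriv (empRisk F fun i => if i ∈ T then s else S i) X lam := by
  intro x hx y hy
  have h1 := hS x hx y hy
  have h2 := empRisk_bregman hdiff S x y
  have h3 := empRisk_bregman hdiff (fun i => if i ∈ T then s else S i) x y
  have h4 : (1 / n : ℝ) * ∑ i, (F y (S i) - F x (S i) - deriv (fun x => F x (S i)) x * (y - x)) ≤
      (1 / n : ℝ) * ∑ i, (F y (if i ∈ T then s else S i) - F x (if i ∈ T then s else S i) -
        deriv (fun x => F x (if i ∈ T then s else S i)) x * (y - x)) := by
    refine mul_le_mul_of_nonneg_left (Finset.sum_le_sum fun i _ => ?_) (by positivity)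
    by_cases hi : i ∈ T
    · simp only [hi, if_true, hs y, hs x, hds x]
      have := le_quadratic_of_deriv_lipschitz (hdiff (S i)) (hsmooth (S i)) x y
      nlinarith
    · simp only [hi, if_false, le_refl]
  linarith

theorem deriv_quadratic_loss {H c : ℝ} {s : 𝒮} (hs : ∀ x, F x s = H / 2 * (x - c) ^ 2) (x : ℝ) :
    deriv (fun x => F x s) x = H * (x - c) := by
  have h1 : HasDerivAt (fun t : ℝ => t - c) 1 x := (hasDerivAt_id x).sub_const c
  have h2 := ((h1.pow 2).const_mul (H / 2))
  rw [funext hs]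
  refine (h2.congr_deriv ?_).deriv
  push_cast
  ring

/-- The minimizer moves by at most `4kHD/(λn)` when at most `k` samples are changed. -/
theorem abs_sub_minimizer_le [DecidableEq 𝒮] {D H lam : ℝ} {k : ℕ}
    (hD : 0 < D) (hH : 0 < H) (hlam : 0 < lam) (hn : 0 < n)
    (hdiff : ∀ s, Differentiable ℝ (fun x => F x s))
    (hb : ∀ s, ∀ x ∈ Set.Icc (-D) D, |deriv (fun x => F x s) x| ≤ 2 * H * D)
    {S S' : Fin n → 𝒮} {x x' : ℝ} (hx : x ∈ Set.Icc (-D) D)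
    (hx0 : ∀ i, deriv (fun x => F x (S i)) x = 0)
    (hS' : StrongConvexOnDeriv (empRisk F S') (Set.Icc (-D) D) lam)
    (hd : hammingDist S S' ≤ k) (hx' : x' ∈ Set.Icc (-D) D)
    (hmin' : IsMinOn (empRisk F S') (Set.Icc (-D) D) x') :
    |x - x'| ≤ 4 * k * H * D / (lam * n) := by
  have hn' : (0 : ℝ) < n := Nat.cast_pos.2 hn
  have hsum : |∑ i, deriv (fun x => F x (S' i)) x| ≤ k * (2 * H * D) := by
    calc _ ≤ ∑ i, |deriv (fun x => F x (S' i)) x| := Finset.abs_sum_le_sum_abs _ _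
      _ ≤ ∑ i, (if S i ≠ S' i then 2 * H * D else 0) := by
        refine Finset.sum_le_sum fun i _ => ?_
        split_ifs with h
        · exact hb _ _ hx
        · rw [← not_not.1 h, hx0, abs_zero]
      _ = hammingDist S S' * (2 * H * D) := by
        rw [← Finset.sum_filter, Finset.sum_const, nsmul_eq_mul]
        rfl
      _ ≤ _ := by
        gcongr
  have hder : |deriv (empRisk F S') x| * n ≤ k * (2 * H * D) := by
    rw [(hasDerivAt_empRisk hdiff S' x).deriv, abs_mul, abs_of_pos (by positivity)]
    field_simp
    linarith
  have h1 := hS' x hx x' hx'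
  have h2 : empRisk F S' x' ≤ empRisk F S' x := hmin' hx
  have h3 : -(deriv (empRisk F S') x * (x' - x)) ≤ |deriv (empRisk F S') x| * |x - x'| := by
    rw [abs_sub_comm x x', ← abs_mul]
    exact neg_le_abs _
  have h4 : lam / 2 * |x - x'| ^ 2 ≤ |deriv (empRisk F S') x| * |x - x'| := by
    rw [sq_abs]
    nlinarith
  rw [le_div_iff₀ (by positivity)]
  rcases (abs_nonneg (x - x')).eq_or_lt with h0 | h0
  · rw [← h0, zero_mul]
    positivity
  · have h5 : lam / 2 * |x - x'| ≤ |deriv (empRisk F S') x| :=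
      le_of_mul_le_mul_right (by linarith) h0
    nlinarith

/-- Replacing `k` samples by a quadratic centered at an endpoint `c` of `[-D, D]` on the other
side of the origin pushes the minimizer by at least `kD/n`. -/
theorem exists_minimizer_far [DecidableEq 𝒮] {D H lam c : ℝ} {k : ℕ}
    (hD : 0 < D) (hH : 0 < H) (hlam : 0 < lam) (hn : 0 < n) (hkn : k ≤ n)
    (hdiff : ∀ s, Differentiable ℝ (fun x => F x s))
    (hsmooth : ∀ s, ∀ x y : ℝ,
      |deriv (fun x => F x s) x - deriv (fun x => F x s) y| ≤ H * |x - y|)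
    {s : 𝒮} (hs : ∀ x, F x s = H / 2 * (x - c) ^ 2) (hc : |c| = D)
    {S : Fin n → 𝒮} (hS : StrongConvexOnDeriv (empRisk F S) (Set.Icc (-D) D) lam)
    {x : ℝ} (hx : x ∈ Set.Icc (-D) D) (hx0 : ∀ i, deriv (fun x => F x (S i)) x = 0)
    (hxc : c * x ≤ 0) :
    ∃ S' : Fin n → 𝒮, StrongConvexOnDeriv (empRisk F S') (Set.Icc (-D) D) lam ∧
      hammingDist S S' ≤ k ∧ ∃ x' ∈ Set.Icc (-D) D,
        IsMinOn (empRisk F S') (Set.Icc (-D) D) x' ∧ (k : ℝ) * D / n ≤ |x - x'| := by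
  have hn' : (0 : ℝ) < n := Nat.cast_pos.2 hn
  have hkn' : (k : ℝ) ≤ n := Nat.cast_le.2 hkn
  have hk0 : (0 : ℝ) ≤ k := Nat.cast_nonneg k
  have hds := deriv_quadratic_loss hs
  obtain ⟨T, -, hT⟩ := Finset.exists_subset_card_eq
    (show k ≤ (Finset.univ : Finset (Fin n)).card by simpa using hkn)
  have hSC := hS.replace hdiff hsmooth hs hds T
  refine ⟨fun i => if i ∈ T then s else S i, hSC, ?_, ?_⟩
  · rw [← hT]
    refine Finset.card_le_card fun i hi => ?_
    by_contra hiT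
    simp [hiT] at hi
  set S' : Fin n → 𝒮 := fun i => if i ∈ T then s else S i with hS'
  obtain ⟨x', hx', hmin'⟩ := isCompact_Icc.exists_isMinOn
    (Set.nonempty_Icc.2 (by linarith : -D ≤ D))
    (f := empRisk F S')
    (continuous_iff_continuousAt.2 fun t =>
      (hasDerivAt_empRisk hdiff S' t).continuousAt).continuousOn
  refine ⟨x', hx', hmin', ?_⟩
  obtain ⟨r, hr⟩ : ∃ r : ℝ, r = k / n := ⟨_, rfl⟩
  have hr0 : 0 ≤ r := hr ▸ by positivity
  have hr1 : r ≤ 1 := hr ▸ (div_le_one hn').2 hkn'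
  have hrn : r * n = k := by rw [hr]; field_simp
  have hc2 : c * c = D * D := by rw [← hc, abs_mul_abs_self]
  have hy : x + r * c ∈ Set.Icc (-D) D := by
    rcases (abs_eq hD.le).1 hc with rfl | rfl
    · exact ⟨by nlinarith [hx.1], by nlinarith [hx.1]⟩
    · exact ⟨by nlinarith [hx.1], by nlinarith [hx.2]⟩
  have hder : deriv (empRisk F S') (x + r * c) * c ≤ 0 := by
    rw [(hasDerivAt_empRisk hdiff S' _).deriv, mul_assoc, Finset.sum_mul]
    refine mul_nonpos_of_nonneg_of_nonpos (by positivity) ?_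
    calc _ ≤ ∑ i, (H * r * D ^ 2 - if i ∈ T then H * D ^ 2 else 0) := by
          refine Finset.sum_le_sum fun i _ => ?_
          by_cases hi : i ∈ T
          · simp only [hS', hi, if_true, hds]
            have h := mul_nonpos_of_nonneg_of_nonpos hH.le hxc
            linear_combination h + (H * r - H) * hc2
          · simp only [hS', hi, if_false, sub_zero]
            have h := hsmooth (S i) (x + r * c) x
            rw [hx0, sub_zero, add_sub_cancel_left, abs_mul, hc, abs_of_nonneg hr0] at h
            calc _ ≤ |deriv (fun x => F x (S i)) (x + r * c) * c| := le_abs_self _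
              _ = |deriv (fun x => F x (S i)) (x + r * c)| * D := by rw [abs_mul, hc]
              _ ≤ H * (r * D) * D := by gcongr
              _ = _ := by ring
      _ = 0 := by
          rw [Finset.sum_sub_distrib, ← Finset.sum_filter]
          simp [hT]
          rw [← hrn]
          ring
  have hside : 0 ≤ (x' - (x + r * c)) * c := by
    by_contra! hneg
    have h1 := hSC _ hy _ hx'
    have h2 : empRisk F S' x' ≤ empRisk F S' (x + r * c) := hmin' hy
    have hne : 0 < (x' - (x + r * c)) ^ 2 := by
      refine sq_pos_of_ne_zero fun h => ?_
      rw [h, zero_mul] at hneg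
      exact lt_irrefl _ hneg
    have h3 := mul_nonneg_of_nonpos_of_nonpos hder hneg.le
    have h4 : 0 ≤ deriv (empRisk F S') (x + r * c) * (x' - (x + r * c)) := by
      refine nonneg_of_mul_nonneg_left (b := D * D) ?_ (by positivity)
      rw [← hc2]
      linarith
    have h5 : 0 < lam / 2 * (x' - (x + r * c)) ^ 2 := by positivity
    linarith
  have hle : (x' - x) * c ≤ |x - x'| * D := by
    rw [abs_sub_comm, ← hc, ← abs_mul]
    exact le_abs_self _
  have hfin : r * D ≤ |x - x'| := le_of_mul_le_mul_right (by nlinarith) hD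
  rwa [hr, div_mul_eq_mul_div] at hfin

/-- A strong convexity modulus is at most the smoothness constant. -/
theorem StrongConvexOnDeriv.le_smoothness {D H lam : ℝ} (hD : 0 < D) (hn : 0 < n)
    (hdiff : ∀ s, Differentiable ℝ (fun x => F x s))
    (hsmooth : ∀ s, ∀ x y : ℝ,
      |deriv (fun x => F x s) x - deriv (fun x => F x s) y| ≤ H * |x - y|)
    {S : Fin n → 𝒮} (hS : StrongConvexOnDeriv (empRisk F S) (Set.Icc (-D) D) lam) :
    lam ≤ H := by
  have hn' : (0 : ℝ) < n := Nat.cast_pos.2 hn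
  have h1 := hS (-D) ⟨le_rfl, by linarith⟩ D ⟨by linarith, le_rfl⟩
  have h2 := empRisk_bregman hdiff S (-D) D
  have h3 : ∑ i, (F D (S i) - F (-D) (S i) - deriv (fun x => F x (S i)) (-D) * (D - -D)) ≤
      ∑ _i : Fin n, H / 2 * (D - -D) ^ 2 :=
    Finset.sum_le_sum fun i _ => by
      linarith [le_quadratic_of_deriv_lipschitz (hdiff (S i)) (hsmooth (S i)) (-D) D]
  have h4 := mul_le_mul_of_nonneg_left h3 (show (0 : ℝ) ≤ 1 / n by positivity)
  rw [Finset.sum_const, Finset.card_univ, Fintype.card_fin, nsmul_eq_mul, ← mul_assoc,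
    one_div_mul_cancel hn'.ne', one_mul] at h4
  have h5 : (0 : ℝ) < (D - -D) ^ 2 := by
    have : 0 < D - -D := by linarith
    positivity
  have h6 : lam / 2 * (D - -D) ^ 2 ≤ H / 2 * (D - -D) ^ 2 := by linarith
  linarith [le_of_mul_le_mul_right h6 h5]

end EmpRisk

/-- Bounds on the modulus of continuity: for an interpolating dataset `S`
whose empirical risk is `L = 2HD`-Lipschitz and `λ`-strongly convex on `X = [−D, D]`, the
modulus `ω(S, k) = sup {|x*_S − x*_{S'}| : F_{S'}` `L`-Lipschitz and `λ`-strongly convex on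
`X`, Hamming distance `≤ k}` satisfies `kD/n ≤ ω(S, k) ≤ 8kHD/(λn)`. -/
theorem stmt_8 {𝒮 : Type*} [DecidableEq 𝒮] (D H lam : ℝ) (n k : ℕ)
    (hD : 0 < D) (hH : 0 < H) (hlam : 0 < lam) (hn : 0 < n) (hk : 0 < k)
    (hkn : lam * n > k * H)
    (F : ℝ → 𝒮 → ℝ)
    (hnonneg : ∀ x s, 0 ≤ F x s)
    (hconv : ∀ s, ConvexOn ℝ Set.univ (fun x => F x s))
    (hdiff : ∀ s, Differentiable ℝ (fun x => F x s))
    (hsmooth : ∀ s, ∀ x y : ℝ,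
      |deriv (fun x => F x s) x - deriv (fun x => F x s) y| ≤ H * |x - y|)
    (hmin : ∀ s, ∃ x ∈ Set.Icc (-D) D, F x s = 0)
    (hsplus : ∃ splus : 𝒮, ∀ x, F x splus = H / 2 * (x - D) ^ 2)
    (hsminus : ∃ sminus : 𝒮, ∀ x, F x sminus = H / 2 * (x + D) ^ 2)
    (S : Fin n → 𝒮)
    (hSlip : LipschitzOnWithReal (empRisk F S) (Set.Icc (-D) D) (2 * H * D))
    (hSsc : StrongConvexOnDeriv (empRisk F S) (Set.Icc (-D) D) lam)
    (hSinterp : IsInterpolation F S (Set.Icc (-D) D))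
    (xS : ℝ) (hxS : xS ∈ Set.Icc (-D) D) (hxSmin : IsMinOn (empRisk F S) (Set.Icc (-D) D) xS) :
    (k : ℝ) * D / n ≤
      sSup {r : ℝ | ∃ S' : Fin n → 𝒮,
        LipschitzOnWithReal (empRisk F S') (Set.Icc (-D) D) (2 * H * D) ∧
        StrongConvexOnDeriv (empRisk F S') (Set.Icc (-D) D) lam ∧
        hammingDist S S' ≤ k ∧
        ∃ xS' ∈ Set.Icc (-D) D,
          IsMinOn (empRisk F S') (Set.Icc (-D) D) xS' ∧ r = |xS - xS'|} ∧
    sSup {r : ℝ | ∃ S' : Fin n → 𝒮,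
        LipschitzOnWithReal (empRisk F S') (Set.Icc (-D) D) (2 * H * D) ∧
        StrongConvexOnDeriv (empRisk F S') (Set.Icc (-D) D) lam ∧
        hammingDist S S' ≤ k ∧
        ∃ xS' ∈ Set.Icc (-D) D,
          IsMinOn (empRisk F S') (Set.Icc (-D) D) xS' ∧ r = |xS - xS'|} ≤
      8 * k * H * D / (lam * n) := by
  have hb : ∀ s, ∀ x ∈ Set.Icc (-D) D, |deriv (fun x => F x s) x| ≤ 2 * H * D :=
    fun s x hx => abs_deriv_le_of_smooth hH.le hnonneg hsmooth hmin s hx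
  have hx0 : ∀ i, deriv (fun x => F x (S i)) xS = 0 := fun i =>
    deriv_eq_zero_of_nonneg (fun x => hnonneg x (S i))
      (hSinterp.eq_zero hn hnonneg (fun s => (hmin s).imp fun _ h => h.2) hxSmin i)
  have hkn' : k ≤ n := by
    have hle := StrongConvexOnDeriv.le_smoothness hD hn hdiff hsmooth hSsc
    have hlt : (k : ℝ) * H < n * H := by
      nlinarith [mul_le_mul_of_nonneg_right hle (Nat.cast_nonneg (α := ℝ) n)]
    exact_mod_cast (lt_of_mul_lt_mul_right hlt hH.le).le
  have hbound : ∀ r ∈ {r : ℝ | ∃ S' : Fin n → 𝒮,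
        LipschitzOnWithReal (empRisk F S') (Set.Icc (-D) D) (2 * H * D) ∧
        StrongConvexOnDeriv (empRisk F S') (Set.Icc (-D) D) lam ∧
        hammingDist S S' ≤ k ∧
        ∃ xS' ∈ Set.Icc (-D) D,
          IsMinOn (empRisk F S') (Set.Icc (-D) D) xS' ∧ r = |xS - xS'|},
      r ≤ 8 * k * H * D / (lam * n) := by
    rintro r ⟨S', -, hsc', hd, x', hx', hmin', rfl⟩
    refine (abs_sub_minimizer_le hD hH hlam hn hdiff hb hxS hx0 hsc' hd hx' hmin').trans ?_
    gcongr
    norm_num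
  refine ⟨?_, Real.sSup_le hbound (by positivity)⟩
  obtain ⟨c, s, hs, hc, hxc⟩ : ∃ c : ℝ, ∃ s : 𝒮, (∀ x, F x s = H / 2 * (x - c) ^ 2) ∧
      |c| = D ∧ c * xS ≤ 0 := by
    rcases le_total xS 0 with h | h
    · obtain ⟨s, hs⟩ := hsplus
      exact ⟨D, s, hs, abs_of_pos hD, mul_nonpos_of_nonneg_of_nonpos hD.le h⟩
    · obtain ⟨s, hs⟩ := hsminus
      exact ⟨-D, s, fun x => by rw [hs, sub_neg_eq_add], by rw [abs_neg, abs_of_pos hD],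
        by nlinarith⟩
  obtain ⟨S', hsc', hd, x', hx', hmin', hfar⟩ :=
    exists_minimizer_far hD hH hlam hn hkn' hdiff hsmooth hs hc hSsc hxS hx0 hxc
  exact hfar.trans (le_csSup ⟨_, hbound⟩
    ⟨S', lipschitzOn_empRisk hn hdiff hb S', hsc', hd, x', hx', hmin', rfl⟩)
end

section
/- Let X ⊆ ℝ^d, let 𝒮 be a sample space, and let F : ℝ^d × 𝒮 → [0,∞) be a loss such that for every s ∈ 𝒮 the function F(·; s) is convex, differentiable, H-smooth, and satisfies inf_{x ∈ ℝ^d} F(x; s) = 0. Let S = (s₁, …, s_n) ∈ 𝒮^n be a dataset such that (F, S) is an interpolation problem over X and F_S has λ-quadratic growth on X. Let I ⊆ {1, …, n} with |I| = k, and define F_{S∖I}(x) = (1/n)·Σ_{i ∉ I} F(x; s_i). If λ·n > k·H, then argmin_{x ∈ X} F_{S∖I}(x) = argmin_{x ∈ X} F_S(x). -/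
open MeasureTheory Real

/-- The set of minimizers of `f` over `X`. -/
def argminOn {E : Type*} (f : E → ℝ) (X : Set E) : Set E := {x ∈ X | IsMinOn f X x}

/-- `f` has `λ`-quadratic growth on `X`. -/
def QuadGrowthOn {E : Type*} [NormedAddCommGroup E] (f : E → ℝ) (X : Set E) (lam : ℝ) : Prop :=
  ∀ x ∈ X, f x - sInf (f '' argminOn f X) ≥ lam / 2 * (Metric.infDist x (argminOn f X)) ^ 2

/-- The quadratic upper bound for a smooth function at a global minimizer. -/
theorem le_add_sq_of_lipschitz_gradient {E : Type*} [NormedAddCommGroup E]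
    [InnerProductSpace ℝ E] [CompleteSpace E] {f : E → ℝ} {H : ℝ} {y : E}
    (hf : Differentiable ℝ f)
    (hH : ∀ x, ‖gradient f x - gradient f y‖ ≤ H * ‖x - y‖)
    (hy : ∀ z, f y ≤ f z) (x : E) : f x ≤ f y + H / 2 * dist x y ^ 2 := by
  have hgrad : gradient f y = 0 := by
    have hmin : IsLocalMin f y := Filter.Eventually.of_forall hy
    simp [gradient, hmin.fderiv_eq_zero]
  set v := x - y with hv
  have hderiv : ∀ t : ℝ, HasDerivAt (fun t : ℝ => f (y + t • v) - H / 2 * ‖v‖ ^ 2 * t ^ 2)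
      (inner ℝ (gradient f (y + t • v)) v - H * ‖v‖ ^ 2 * t) t := by
    intro t
    have hline : HasDerivAt (fun t : ℝ => y + t • v) v t := by
      simpa using ((hasDerivAt_id t).smul_const v).const_add y
    have hcomp := (hf (y + t • v)).hasGradientAt.hasFDerivAt.comp_hasDerivAt t hline
    have hsq := (hasDerivAt_pow 2 t).const_mul (H / 2 * ‖v‖ ^ 2)
    refine (hcomp.sub hsq).congr_deriv ?_
    simp only [InnerProductSpace.toDual_apply_apply]
    norm_num
    ring
  have hanti : AntitoneOn (fun t : ℝ => f (y + t • v) - H / 2 * ‖v‖ ^ 2 * t ^ 2)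
      (Set.Icc 0 1) := by
    refine antitoneOn_of_deriv_nonpos (convex_Icc 0 1)
      (fun t _ => (hderiv t).continuousAt.continuousWithinAt)
      (fun t _ => (hderiv t).differentiableAt.differentiableWithinAt) fun t ht => ?_
    rw [interior_Icc] at ht
    rw [(hderiv t).deriv, sub_nonpos]
    have hbound := hH (y + t • v)
    rw [hgrad, sub_zero, add_sub_cancel_left, norm_smul, Real.norm_of_nonneg ht.1.le] at hbound
    calc inner ℝ (gradient f (y + t • v)) v
        ≤ ‖gradient f (y + t • v)‖ * ‖v‖ := real_inner_le_norm _ _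
      _ ≤ H * (t * ‖v‖) * ‖v‖ := by gcongr
      _ = H * ‖v‖ ^ 2 * t := by ring
  have hends := hanti (Set.left_mem_Icc.2 zero_le_one) (Set.right_mem_Icc.2 zero_le_one)
    zero_le_one
  simp only [one_smul, zero_smul, add_zero, hv, add_sub_cancel] at hends
  rw [dist_eq_norm]
  linarith

/-- A bound by a multiple of the squared distance to every point of a set passes to the
distance to the set. -/
theorem le_mul_infDist_sq {E : Type*} [PseudoMetricSpace E] [ProperSpace E] {A : Set E}
    (hA : A.Nonempty) {x : E} {v c : ℝ} (h : ∀ y ∈ A, v ≤ c * dist x y ^ 2) :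
    v ≤ c * Metric.infDist x A ^ 2 := by
  obtain ⟨y, hy, hxy⟩ := Metric.exists_mem_closure_infDist_eq_dist hA x
  rw [hxy]
  have hclosed : IsClosed {y | v ≤ c * dist x y ^ 2} :=
    isClosed_le continuous_const (by fun_prop)
  exact closure_minimal h hclosed hy

/-- If `f` is nonnegative and vanishes somewhere on `X`, its minimizers over `X` are its zeros. -/
theorem mem_argminOn_iff_of_nonneg {E : Type*} {f : E → ℝ} {X : Set E} (hf : ∀ x, 0 ≤ f x)
    {z : E} (hz : z ∈ X) (hfz : f z = 0) {x : E} : x ∈ argminOn f X ↔ x ∈ X ∧ f x = 0 := by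
  refine and_congr_right fun _ => ⟨fun h => le_antisymm (hfz ▸ h hz) (hf x), fun h y _ => ?_⟩
  simpa [h] using hf y

/-- Removing `k` samples from an interpolating dataset whose empirical risk
has `λ`-quadratic growth does not change the set of minimizers over `X`, provided
`λn > kH`. -/
theorem stmt_9 {𝒮 : Type*} (d n k : ℕ) (H lam : ℝ) (hH : 0 < H) (hlam : 0 < lam)
    (hn : 0 < n)
    (X : Set (EuclideanSpace ℝ (Fin d)))
    (F : EuclideanSpace ℝ (Fin d) → 𝒮 → ℝ)
    (hnonneg : ∀ x s, 0 ≤ F x s)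
    (hconv : ∀ s, ConvexOn ℝ Set.univ (fun x => F x s))
    (hdiff : ∀ s, Differentiable ℝ (fun x => F x s))
    (hsmooth : ∀ s, ∀ x y : EuclideanSpace ℝ (Fin d),
      ‖gradient (fun x => F x s) x - gradient (fun x => F x s) y‖ ≤ H * ‖x - y‖)
    (hinf : ∀ s, (⨅ x, F x s) = 0)
    (S : Fin n → 𝒮)
    (hinterp : IsInterpolation F S X)
    (hgrowth : QuadGrowthOn (empRisk F S) X lam)
    (I : Finset (Fin n)) (hI : I.card = k)
    (hkn : lam * n > k * H) :
    argminOn (fun x => (1 / n : ℝ) * ∑ i ∈ Iᶜ, F x (S i)) X = argminOn (empRisk F S) X := by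
  obtain ⟨z, hzX, -, hzmin⟩ := hinterp
  have hn' : (0 : ℝ) < n := Nat.cast_pos.2 hn
  have hz : ∀ i, F z (S i) = 0 := fun i =>
    le_antisymm (hinf (S i) ▸ le_ciInf (hzmin i)) (hnonneg _ _)
  have hzero : ∀ (J : Finset (Fin n)) (x : EuclideanSpace ℝ (Fin d)),
      (1 / n : ℝ) * ∑ i ∈ J, F x (S i) = 0 ↔ ∀ i ∈ J, F x (S i) = 0 := by
    intro J x
    rw [mul_eq_zero, or_iff_right (by positivity),
      Finset.sum_eq_zero_iff_of_nonneg fun i _ => hnonneg x (S i)]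
  have hpos : ∀ (J : Finset (Fin n)) (x : EuclideanSpace ℝ (Fin d)),
      0 ≤ (1 / n : ℝ) * ∑ i ∈ J, F x (S i) := fun J x =>
    mul_nonneg (by positivity) (Finset.sum_nonneg fun i _ => hnonneg x (S i))
  have hmem : ∀ x, x ∈ argminOn (empRisk F S) X ↔ x ∈ X ∧ ∀ i, F x (S i) = 0 := by
    intro x
    refine (mem_argminOn_iff_of_nonneg (hpos Finset.univ) hzX
      ((hzero _ z).2 fun i _ => hz i)).trans (and_congr_right fun _ => ?_)
    simpa only [Finset.mem_univ, true_imp_iff] using hzero Finset.univ x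
  have hzA : z ∈ argminOn (empRisk F S) X := (hmem z).2 ⟨hzX, hz⟩
  ext x
  rw [mem_argminOn_iff_of_nonneg (hpos Iᶜ) hzX ((hzero _ z).2 fun i _ => hz i), hzero, hmem]
  refine and_congr_right fun hx => ⟨fun hxI => ?_, fun h i _ => h i⟩
  have hmin : sInf (empRisk F S '' argminOn (empRisk F S) X) = 0 := by
    have himage : empRisk F S '' argminOn (empRisk F S) X = {0} := by
      refine Set.eq_singleton_iff_nonempty_unique_mem.2 ⟨⟨_, z, hzA, rfl⟩, ?_⟩
      rintro _ ⟨y, hy, rfl⟩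
      exact (hzero _ y).2 fun i _ => ((hmem y).1 hy).2 i
    rw [himage, csInf_singleton]
  have hlower := hgrowth x hx
  rw [hmin, sub_zero] at hlower
  have hupper : empRisk F S x ≤
      (k * H / (2 * n)) * Metric.infDist x (argminOn (empRisk F S) X) ^ 2 := by
    refine le_mul_infDist_sq ⟨z, hzA⟩ fun y hy => ?_
    have hy0 := ((hmem y).1 hy).2
    have hquad : ∀ i, F x (S i) ≤ H / 2 * dist x y ^ 2 := fun i => by
      simpa [hy0 i] using le_add_sq_of_lipschitz_gradient (hdiff (S i))
        (fun w => hsmooth (S i) w y) (fun w => by simpa [hy0 i] using hnonneg w (S i)) x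
    have hsum : ∑ i, F x (S i) ≤ k * (H / 2 * dist x y ^ 2) := by
      rw [← Finset.sum_add_sum_compl I, Finset.sum_eq_zero hxI, add_zero, ← hI, ← nsmul_eq_mul]
      exact Finset.sum_le_card_nsmul _ _ _ fun i _ => hquad i
    calc empRisk F S x ≤ (1 / n : ℝ) * (k * (H / 2 * dist x y ^ 2)) := by
          unfold empRisk; gcongr
      _ = k * H / (2 * n) * dist x y ^ 2 := by field_simp
  have hconst : k * H / (2 * n) < lam / 2 := by
    rw [div_lt_div_iff₀ (by positivity) two_pos]
    linarith
  have hdist : Metric.infDist x (argminOn (empRisk F S) X) ^ 2 = 0 := by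
    refine le_antisymm ?_ (sq_nonneg _)
    by_contra! h
    nlinarith
  rw [hdist, mul_zero] at hupper
  exact fun i => (hzero Finset.univ x).1 (le_antisymm hupper (hpos _ x)) i (Finset.mem_univ i)
end

section
/- Let D > 0 and let h, g : [−D, D] → [0,∞) be convex and differentiable. Let x_h* be the largest minimizer of h and x_g* the smallest minimizer of g over [−D, D], with x_h* ≤ x_g*, h(x_h*) = 0, g(x_g*) = 0, h'(x_h*) = 0 and g'(x_g*) = 0. Let x* be any minimizer of h + g over [−D, D]. If h has λ_h-quadratic growth on [−D, D] and g is H_g-smooth, then x* − x_h* ≤ H_g·(x_g* − x_h*) / (λ_h/2 + H_g). -/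
open Real

/-- Control of the minimizer of a sum: on `[−D, D]`, let `x_h*` be the
largest minimizer of `h` and `x_g*` the smallest minimizer of `g`, with `x_h* ≤ x_g*`,
`h(x_h*) = g(x_g*) = 0` and vanishing derivatives there. If `h` has `λ_h`-quadratic growth
on `[−D, D]` and `g` is `H_g`-smooth, then any minimizer `x*` of `h + g` over `[−D, D]`
satisfies `x* − x_h* ≤ H_g(x_g* − x_h*)/(λ_h/2 + H_g)`. -/
theorem stmt_13 (D lamh Hg : ℝ) (hD : 0 < D) (hlamh : 0 < lamh) (hHg : 0 < Hg)
    (h g : ℝ → ℝ)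
    (hconvh : ConvexOn ℝ (Set.Icc (-D) D) h) (hconvg : ConvexOn ℝ (Set.Icc (-D) D) g)
    (hdiffh : Differentiable ℝ h) (hdiffg : Differentiable ℝ g)
    (hnonnegh : ∀ x ∈ Set.Icc (-D) D, 0 ≤ h x) (hnonnegg : ∀ x ∈ Set.Icc (-D) D, 0 ≤ g x)
    (xh xg : ℝ)
    (hxhmem : xh ∈ Set.Icc (-D) D) (hxhmin : IsMinOn h (Set.Icc (-D) D) xh)
    (hxhmax : ∀ y ∈ Set.Icc (-D) D, IsMinOn h (Set.Icc (-D) D) y → y ≤ xh)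
    (hxgmem : xg ∈ Set.Icc (-D) D) (hxgmin : IsMinOn g (Set.Icc (-D) D) xg)
    (hxgleast : ∀ y ∈ Set.Icc (-D) D, IsMinOn g (Set.Icc (-D) D) y → xg ≤ y)
    (hle : xh ≤ xg) (hh0 : h xh = 0) (hg0 : g xg = 0)
    (hdh0 : deriv h xh = 0) (hdg0 : deriv g xg = 0)
    (xstar : ℝ) (hxstarmem : xstar ∈ Set.Icc (-D) D)
    (hxstarmin : IsMinOn (fun x => h x + g x) (Set.Icc (-D) D) xstar)
    (hgrowth : ∀ x ∈ Set.Icc (-D) D,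
      h x - sInf (h '' {y ∈ Set.Icc (-D) D | IsMinOn h (Set.Icc (-D) D) y}) ≥
        lamh / 2 * (Metric.infDist x {y ∈ Set.Icc (-D) D | IsMinOn h (Set.Icc (-D) D) y}) ^ 2)
    (hsmoothg : ∀ x y : ℝ, |deriv g x - deriv g y| ≤ Hg * |x - y|) :
    xstar - xh ≤ Hg * (xg - xh) / (lamh / 2 + Hg) := by
  have hRHS : 0 ≤ Hg * (xg - xh) / (lamh / 2 + Hg) :=
    div_nonneg (mul_nonneg hHg.le (sub_nonneg.2 hle)) (by positivity)
  rcases le_or_gt xstar xh with hx | hx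
  · linarith
  set S := {y ∈ Set.Icc (-D) D | IsMinOn h (Set.Icc (-D) D) y}
  have hdist : xstar - xh ≤ Metric.infDist xstar S := by
    refine (Metric.le_infDist (s := S) ⟨xh, hxhmem, hxhmin⟩).2 fun y hy => ?_
    have hyle := hxhmax y hy.1 hy.2
    rw [Real.dist_eq]
    exact (by linarith : xstar - xh ≤ xstar - y).trans (le_abs_self _)
  have hinf : 0 ≤ sInf (h '' S) := by
    refine Real.sInf_nonneg ?_
    rintro _ ⟨y, hy, rfl⟩
    exact hnonnegh y hy.1
  have hgrow : lamh / 2 * (xstar - xh) ^ 2 ≤ h xstar := by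
    have hsq : (xstar - xh) ^ 2 ≤ Metric.infDist xstar S ^ 2 :=
      pow_le_pow_left₀ (by linarith) hdist 2
    have hmul := mul_le_mul_of_nonneg_left hsq (by positivity : 0 ≤ lamh / 2)
    linarith [hgrowth xstar hxstarmem]
  have hslope : lamh / 2 * (xstar - xh) ≤ deriv h xstar := by
    have hle_deriv := hconvh.slope_le_deriv hxhmem hxstarmem hx (hdiffh xstar)
    refine le_trans ?_ hle_deriv
    rw [slope_def_field, hh0, le_div_iff₀ (by linarith)]
    linarith
  have hfirst : deriv h xstar + deriv g xstar ≤ 0 := by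
    have hderiv : HasDerivAt (fun x => h x + g x) (deriv h xstar + deriv g xstar) xstar :=
      (hdiffh xstar).hasDerivAt.add (hdiffg xstar).hasDerivAt
    have hnonneg := hxstarmin.localize.hasFDerivWithinAt_nonneg
      hderiv.hasFDerivAt.hasFDerivWithinAt
      (sub_mem_posTangentConeAt_of_segment_subset
        ((convex_Icc (-D) D).segment_subset hxstarmem hxhmem))
    simp only [ContinuousLinearMap.toSpanSingleton_apply, smul_eq_mul] at hnonneg
    nlinarith
  have hpos : 0 < lamh / 2 * (xstar - xh) := mul_pos (by positivity) (by linarith)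
  have hxg : xstar ≤ xg := by
    by_contra! hlt
    have hle_deriv := hconvg.slope_le_deriv hxgmem hxstarmem hlt (hdiffg xstar)
    rw [slope_def_field, hg0] at hle_deriv
    have hquot : 0 ≤ (g xstar - 0) / (xstar - xg) :=
      div_nonneg (by linarith [hnonnegg xstar hxstarmem]) (by linarith)
    linarith
  have hlip := (le_abs_self _).trans (hsmoothg xg xstar)
  rw [hdg0, abs_of_nonneg (sub_nonneg.2 hxg)] at hlip
  rw [le_div_iff₀ (by positivity)]
  linarith
end

section
/- Let D > 0 and let h, g : [−D, D] → [0,∞) be convex and differentiable. Let x_h* be the largest minimizer of h and x_g* the smallest minimizer of g over [−D, D], with x_h* ≤ x_g*, h(x_h*) = 0, g(x_g*) = 0, h'(x_h*) = 0 and g'(x_g*) = 0. Let x* be any minimizer of h + g over [−D, D]. If h is H_h-smooth and g has λ_g-quadratic growth on [−D, D], then x* − x_h* ≥ (λ_g/2)·(x_g* − x_h*) / (λ_g/2 + H_h). Moreover, if instead g is λ_g-strongly convex, the same lower bound holds with λ_g/2 replaced by λ_g, i.e. x* − x_h* ≥ λ_g·(x_g* − x_h*) / (λ_g + H_h). -/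
open Real

/-- A differentiable function on `ℝ` has nonnegative derivative towards any point of a convex set
on which it is minimized. -/
lemma deriv_mul_sub_nonneg_of_isMinOn {s : Set ℝ} (hs : Convex ℝ s) {f : ℝ → ℝ} {x y : ℝ}
    (hf : DifferentiableAt ℝ f x) (hx : x ∈ s) (hy : y ∈ s) (hmin : IsMinOn f s x) :
    0 ≤ deriv f x * (y - x) := by
  have key := hmin.localize.hasFDerivWithinAt_nonneg
    hf.hasDerivAt.hasFDerivAt.hasFDerivWithinAt
    (sub_mem_posTangentConeAt_of_segment_subset (hs.segment_subset hx hy))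
  simpa [mul_comm] using key

/-- A convex function lies above its tangents. -/
lemma ConvexOn.add_deriv_mul_sub_le {s : Set ℝ} {f : ℝ → ℝ} (hconv : ConvexOn ℝ s f) {x y : ℝ}
    (hf : DifferentiableAt ℝ f x) (hx : x ∈ s) (hy : y ∈ s) (hxy : x < y) :
    f x + deriv f x * (y - x) ≤ f y := by
  have key := hconv.deriv_le_slope hx hy hxy hf
  rw [slope_def_field, le_div_iff₀ (sub_pos.2 hxy)] at key
  linarith

/-- The minimizer of a sum is not to the left of a minimizer of the first summand that precedes
the least zero of the second, convex, nonnegative summand. -/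
lemma le_of_isMinOn_add {s : Set ℝ} {h g : ℝ → ℝ} (hconv : ConvexOn ℝ s g)
    (hg : ∀ x ∈ s, 0 ≤ g x) {a b x : ℝ} (ha : a ∈ s) (hmin : IsMinOn h s a) (hb : b ∈ s)
    (hleast : ∀ y ∈ s, IsMinOn g s y → b ≤ y) (hab : a ≤ b) (hg0 : g b = 0) (hx : x ∈ s)
    (hxmin : IsMinOn (fun y => h y + g y) s x) : a ≤ x := by
  by_contra! hxa
  have h1 : h x + g x ≤ h a + g a := isMinOn_iff.1 hxmin a ha
  have h2 : h a ≤ h x := isMinOn_iff.1 hmin x hx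
  have hpos : 0 < b - x := by linarith
  have hcomb := hconv.2 hx hb (div_nonneg (sub_nonneg.2 hab) hpos.le)
    (div_nonneg (sub_nonneg.2 hxa.le) hpos.le) (by field_simp; ring)
  have hpt : ((b - a) / (b - x)) • x + ((a - x) / (b - x)) • b = a := by
    simp only [smul_eq_mul]
    field_simp
    ring
  rw [hpt, hg0, smul_zero, add_zero, smul_eq_mul, div_mul_eq_mul_div, le_div_iff₀ hpos] at hcomb
  have hgx : g x = 0 := by nlinarith [hg x hx]
  have := hleast x hx (isMinOn_iff.2 fun y hy => hgx.le.trans (hg y hy))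
  linarith

/-- Control of the minimizer of a sum, lower bound: on `[−D, D]`, let
`x_h*` be the largest minimizer of `h` and `x_g*` the smallest minimizer of `g`, with
`x_h* ≤ x_g*`, `h(x_h*) = g(x_g*) = 0` and vanishing derivatives there, and let `x*` be any
minimizer of `h + g` over `[−D, D]`. If `h` is `H_h`-smooth and `g` has `λ_g`-quadratic
growth on `[−D, D]`, then `x* − x_h* ≥ (λ_g/2)(x_g* − x_h*)/(λ_g/2 + H_h)`; if instead `g`
is `λ_g`-strongly convex, then `x* − x_h* ≥ λ_g(x_g* − x_h*)/(λ_g + H_h)`. -/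
theorem stmt_14 (D lamg Hh : ℝ) (hD : 0 < D) (hlamg : 0 < lamg) (hHh : 0 < Hh)
    (h g : ℝ → ℝ)
    (hconvh : ConvexOn ℝ (Set.Icc (-D) D) h) (hconvg : ConvexOn ℝ (Set.Icc (-D) D) g)
    (hdiffh : Differentiable ℝ h) (hdiffg : Differentiable ℝ g)
    (hnonnegh : ∀ x ∈ Set.Icc (-D) D, 0 ≤ h x) (hnonnegg : ∀ x ∈ Set.Icc (-D) D, 0 ≤ g x)
    (xh xg : ℝ)
    (hxhmem : xh ∈ Set.Icc (-D) D) (hxhmin : IsMinOn h (Set.Icc (-D) D) xh)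
    (hxhmax : ∀ y ∈ Set.Icc (-D) D, IsMinOn h (Set.Icc (-D) D) y → y ≤ xh)
    (hxgmem : xg ∈ Set.Icc (-D) D) (hxgmin : IsMinOn g (Set.Icc (-D) D) xg)
    (hxgleast : ∀ y ∈ Set.Icc (-D) D, IsMinOn g (Set.Icc (-D) D) y → xg ≤ y)
    (hle : xh ≤ xg) (hh0 : h xh = 0) (hg0 : g xg = 0)
    (hdh0 : deriv h xh = 0) (hdg0 : deriv g xg = 0)
    (xstar : ℝ) (hxstarmem : xstar ∈ Set.Icc (-D) D)
    (hxstarmin : IsMinOn (fun x => h x + g x) (Set.Icc (-D) D) xstar)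
    (hsmoothh : ∀ x y : ℝ, |deriv h x - deriv h y| ≤ Hh * |x - y|) :
    ((∀ x ∈ Set.Icc (-D) D,
        g x - sInf (g '' {y ∈ Set.Icc (-D) D | IsMinOn g (Set.Icc (-D) D) y}) ≥
          lamg / 2 *
            (Metric.infDist x {y ∈ Set.Icc (-D) D | IsMinOn g (Set.Icc (-D) D) y}) ^ 2) →
      xstar - xh ≥ lamg / 2 * (xg - xh) / (lamg / 2 + Hh)) ∧
    ((∀ x ∈ Set.Icc (-D) D, ∀ y ∈ Set.Icc (-D) D,
        g y ≥ g x + deriv g x * (y - x) + lamg / 2 * (y - x) ^ 2) →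
      xstar - xh ≥ lamg * (xg - xh) / (lamg + Hh)) := by
  have hxs : xh ≤ xstar := le_of_isMinOn_add hconvg hnonnegg hxhmem hxhmin hxgmem hxgleast hle hg0
    hxstarmem hxstarmin
  have key : ∀ c : ℝ, 0 < c → (xstar < xg → c * (xg - xstar) ≤ -deriv g xstar) →
      xstar - xh ≥ c * (xg - xh) / (c + Hh) := by
    intro c hc hslope
    rw [ge_iff_le, div_le_iff₀ (by positivity)]
    rcases lt_or_ge xstar xg with hlt | hge
    · have hopt := deriv_mul_sub_nonneg_of_isMinOn (convex_Icc (-D) D)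
        ((hdiffh xstar).fun_add (hdiffg xstar)) hxstarmem hxgmem hxstarmin
      rw [deriv_fun_add (hdiffh xstar) (hdiffg xstar)] at hopt
      have hsum := nonneg_of_mul_nonneg_left hopt (sub_pos.2 hlt)
      have hsm := (le_abs_self _).trans (hsmoothh xstar xh)
      rw [hdh0, abs_of_nonneg (sub_nonneg.2 hxs)] at hsm
      linarith [hslope hlt]
    · nlinarith [mul_nonneg hc.le (sub_nonneg.2 hge), mul_nonneg hHh.le (sub_nonneg.2 hxs)]
  refine ⟨fun hgrowth => key _ (by positivity) fun hlt => ?_,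
    fun hstrong => key _ hlamg fun hlt => ?_⟩
  · have hne : {y ∈ Set.Icc (-D) D | IsMinOn g (Set.Icc (-D) D) y}.Nonempty :=
      ⟨xg, hxgmem, hxgmin⟩
    have hinf : 0 ≤ sInf (g '' {y ∈ Set.Icc (-D) D | IsMinOn g (Set.Icc (-D) D) y}) :=
      Real.sInf_nonneg (by rintro _ ⟨y, hy, rfl⟩; exact hnonnegg y hy.1)
    have hdist : xg - xstar ≤
        Metric.infDist xstar {y ∈ Set.Icc (-D) D | IsMinOn g (Set.Icc (-D) D) y} := by
      refine (Metric.le_infDist hne).2 fun y hy => ?_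
      rw [dist_comm, Real.dist_eq]
      exact (sub_le_sub_right (hxgleast y hy.1 hy.2) _).trans (le_abs_self _)
    have hgr := hgrowth xstar hxstarmem
    have hsq := mul_le_mul_of_nonneg_left (pow_le_pow_left₀ (sub_pos.2 hlt).le hdist 2)
      (half_pos hlamg).le
    have htan := hconvg.add_deriv_mul_sub_le (hdiffg xstar) hxstarmem hxgmem hlt
    refine le_of_mul_le_mul_right ?_ (sub_pos.2 hlt)
    have hval : lamg / 2 * (xg - xstar) ^ 2 ≤ g xstar := by linarith [hgr, hsq, hinf]
    nlinarith
  · have h1 := hstrong xstar hxstarmem xg hxgmem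
    have h2 := hstrong xg hxgmem xstar hxstarmem
    rw [hdg0] at h2
    refine le_of_mul_le_mul_right ?_ (sub_pos.2 hlt)
    nlinarith
end

section
/- Let X ⊆ ℝ^d be convex and closed, let 𝒮 be a sample space, and let F : X × 𝒮 → [0,∞) be a loss such that for every s ∈ 𝒮 the function F(·; s) is convex and L-Lipschitz on X with inf_{x ∈ X} F(x; s) = 0. Let S, S' ∈ 𝒮^n be datasets whose Hamming distance is at most k. Suppose the empirical risk F_S is λ-strongly convex on X and (F, S) is an interpolation problem over X, with x*_S ∈ argmin_{x ∈ X} F_S(x) the interpolating minimizer, and let x*_{S'} ∈ argmin_{x ∈ X} F_{S'}(x). Then ‖x*_S − x*_{S'}‖₂ ≤ 4·k·L / (λ·n). -/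
open Real

/-- A strongly convex function grows at least quadratically away from a minimizer. -/
lemma StrongConvexOn.quadratic_growth {E : Type*} [NormedAddCommGroup E] [NormedSpace ℝ E]
    {X : Set E} {m : ℝ} {f : E → ℝ} (hf : StrongConvexOn X m f) {x y : E}
    (hx : x ∈ X) (hy : y ∈ X) (hmin : IsMinOn f X x) :
    m / 2 * ‖x - y‖ ^ 2 ≤ f y - f x := by
  have hD : f x ≤ f y := hmin hy
  have key : ∀ t : ℝ, 0 < t → t < 1 → (1 - t) * (m / 2 * ‖x - y‖ ^ 2) ≤ f y - f x := by
    intro t ht0 ht1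
    have h1 := hf.2 hx hy (sub_nonneg.2 ht1.le) ht0.le (by ring)
    have h2 : f x ≤ f ((1 - t) • x + t • y) :=
      hmin (hf.1 hx hy (sub_nonneg.2 ht1.le) ht0.le (by ring))
    simp only [smul_eq_mul] at h1
    refine le_of_mul_le_mul_left ?_ ht0
    linarith
  set c := m / 2 * ‖x - y‖ ^ 2
  by_contra! hlt
  have hc : 0 < c := by linarith
  have h := key ((c - (f y - f x)) / (2 * c)) (div_pos (by linarith) (by linarith))
    ((div_lt_one (by linarith)).2 (by linarith))
  have e : (1 - (c - (f y - f x)) / (2 * c)) * c = (c + (f y - f x)) / 2 := by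
    field_simp
    ring
  linarith

/-- Replacing at most `k` samples changes increments of the empirical risk by at most
`2kL/n` times the distance. -/
lemma empRisk_sub_le_of_hammingDist_le {E 𝒮 : Type*} [SeminormedAddCommGroup E] [DecidableEq 𝒮]
    {n k : ℕ} {L : ℝ} (hL : 0 ≤ L) {X : Set E} {F : E → 𝒮 → ℝ}
    (hlip : ∀ s : 𝒮, ∀ x ∈ X, ∀ y ∈ X, |F x s - F y s| ≤ L * ‖x - y‖)
    {S S' : Fin n → 𝒮} (hham : hammingDist S S' ≤ k) {x y : E} (hx : x ∈ X) (hy : y ∈ X) :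
    (empRisk F S y - empRisk F S x) - (empRisk F S' y - empRisk F S' x)
      ≤ 1 / n * (k * (2 * (L * ‖x - y‖))) := by
  have hsum : ∑ i, ((F y (S i) - F x (S i)) - (F y (S' i) - F x (S' i)))
      ≤ k * (2 * (L * ‖x - y‖)) := by
    calc ∑ i, ((F y (S i) - F x (S i)) - (F y (S' i) - F x (S' i)))
        ≤ ∑ i, if S i ≠ S' i then 2 * (L * ‖x - y‖) else 0 := by
          refine Finset.sum_le_sum fun i _ => ?_
          split_ifs with h
          · have h1 := (abs_le.1 (hlip (S i) x hx y hy)).1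
            have h2 := (abs_le.1 (hlip (S' i) x hx y hy)).2
            linarith
          · simp [not_not.1 h]
      _ = hammingDist S S' * (2 * (L * ‖x - y‖)) := by
          rw [← Finset.sum_filter, Finset.sum_const, nsmul_eq_mul]
          rfl
      _ ≤ k * (2 * (L * ‖x - y‖)) := by gcongr
  calc (empRisk F S y - empRisk F S x) - (empRisk F S' y - empRisk F S' x)
      = 1 / n * ∑ i, ((F y (S i) - F x (S i)) - (F y (S' i) - F x (S' i))) := by
        simp only [empRisk, Finset.sum_sub_distrib]
        ring
    _ ≤ 1 / n * (k * (2 * (L * ‖x - y‖))) := by gcongr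

/-- Stability of the minimizer: if `F_S` is `λ`-strongly convex on a
closed convex set `X`, `(F, S)` is an interpolation problem over `X` with interpolating
minimizer `x*_S` (so `0 ∈ ∂F(x*_S; sᵢ)` for all `i`, i.e. `x*_S` minimizes every sample
loss over `X`), each sample loss is convex, `L`-Lipschitz and nonnegative on `X` with
infimum `0`, and `S'` is within Hamming distance `k` of `S`, then any minimizer `x*_{S'}`
of `F_{S'}` over `X` satisfies `‖x*_S − x*_{S'}‖ ≤ 4kL/(λn)`. -/
theorem stmt_15 {𝒮 : Type*} [DecidableEq 𝒮] (d n k : ℕ) (L lam : ℝ)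
    (hL : 0 < L) (hlam : 0 < lam) (hn : 0 < n)
    (X : Set (EuclideanSpace ℝ (Fin d))) (hXconv : Convex ℝ X) (hXclosed : IsClosed X)
    (F : EuclideanSpace ℝ (Fin d) → 𝒮 → ℝ)
    (hnonneg : ∀ x ∈ X, ∀ s : 𝒮, 0 ≤ F x s)
    (hconv : ∀ s, ConvexOn ℝ X (fun x => F x s))
    (hlip : ∀ s : 𝒮, ∀ x ∈ X, ∀ y ∈ X, |F x s - F y s| ≤ L * ‖x - y‖)
    (hinf : ∀ s : 𝒮, sInf ((fun x => F x s) '' X) = 0)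
    (S S' : Fin n → 𝒮) (hham : hammingDist S S' ≤ k)
    (hsc : StrongConvexOn X lam (empRisk F S))
    (xS : EuclideanSpace ℝ (Fin d)) (hxSmem : xS ∈ X)
    (hxSmin : IsMinOn (empRisk F S) X xS)
    (hinterp : ∀ i, ∀ y ∈ X, F xS (S i) ≤ F y (S i))
    (xS' : EuclideanSpace ℝ (Fin d)) (hxS'mem : xS' ∈ X)
    (hxS'min : IsMinOn (empRisk F S') X xS') :
    ‖xS - xS'‖ ≤ 4 * k * L / (lam * n) := by
  have hgrowth := hsc.quadratic_growth hxSmem hxS'mem hxSmin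
  have hdiff := empRisk_sub_le_of_hammingDist_le hL.le hlip hham hxSmem hxS'mem
  have hmin : empRisk F S' xS' ≤ empRisk F S' xS := hxS'min hxSmem
  have hn' : (0 : ℝ) < n := Nat.cast_pos.2 hn
  rcases (norm_nonneg (xS - xS')).eq_or_lt with h0 | hpos
  · rw [← h0]
    positivity
  · rw [le_div_iff₀ (by positivity)]
    have h : lam / 2 * ‖xS - xS'‖ ^ 2 ≤ 1 / n * (k * (2 * (L * ‖xS - xS'‖))) := by linarith
    rw [one_div, inv_mul_eq_div, le_div_iff₀ hn'] at h
    refine le_of_mul_le_mul_right ?_ hpos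
    linarith
end
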